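/- arXiv:1705.10592 — 2 statements merged into one kernel-verified Lean document; each statement's English description precedes it below -/
import Mathlib

section
/- Let q be a prime power, m, α, n, ℓ ≥ 1 and t ≥ 0 integers, and let (C_S) be a coset coding scheme with message set F_{q^m}^{α×ℓ} and codeword set F_{q^m}^{α×n}. Let A ∈ F_q^{d×n} have rank d with d ≥ 2t and rows a_1,…,a_d, and suppose the preprocessing functions E_{A,i} : F_{q^m}^α → F_{q^m}^{β_i} (i = 1,…,d) are t-error-correcting with respect to the scheme. Then the functions E_{A,1},…,E_{A,d−2t} are 0-error-correcting with respect to the scheme for the submatrix of A consisting of its first d − 2t rows; that is, there exists a function D : ∏_{i=1}^{d−2t} F_{q^m}^{β_i} → F_{q^m}^{α×ℓ} such that D((E_{A,i}(C a_i^T))_{i=1}^{d−2t}) = S for every message S and every C ∈ C_S. -/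
open Matrix

/-- The rank over `Fq` of a row vector with entries in `Fqm`. -/
noncomputable def rkVec (Fq : Type*) [Field Fq] {Fqm : Type*} [Field Fqm] [Algebra Fq Fqm]
    {n : ℕ} (v : Fin n → Fqm) : ℕ :=
  Module.finrank Fq (Submodule.span Fq (Set.range v))

/-- The rank over `Fq` of a matrix with entries in `Fqm`: the dimension over `Fq`
of the `Fq`-span of its columns. -/
noncomputable def rkMat (Fq : Type*) [Field Fq] {Fqm : Type*} [Field Fqm] [Algebra Fq Fqm]
    {a N : ℕ} (E : Matrix (Fin a) (Fin N) Fqm) : ℕ :=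
  Module.finrank Fq (Submodule.span Fq (Set.range fun j : Fin N => fun i : Fin a => E i j))

/-- The relative minimum rank distance `d_R(C1, C2)` of (sets of) codewords. -/
noncomputable def dRel (Fq : Type*) [Field Fq] {Fqm : Type*} [Field Fqm] [Algebra Fq Fqm]
    {n : ℕ} (C1 C2 : Set (Fin n → Fqm)) : ℕ :=
  sInf {r | ∃ c ∈ C1, c ∉ C2 ∧ rkVec Fq c = r}

/-- The dual code w.r.t. the standard bilinear form `⟨x,y⟩ = ∑ i, x i * y i`. -/
def dualCode {K : Type*} [Field K] {n : ℕ} (C : Set (Fin n → K)) : Submodule K (Fin n → K) where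
  carrier := {y | ∀ x ∈ C, ∑ i, x i * y i = 0}
  zero_mem' := by intro x hx; simp
  add_mem' := by
    intro a b ha hb x hx
    have h1 := ha x hx
    have h2 := hb x hx
    simp only [Pi.add_apply, mul_add, Finset.sum_add_distrib, h1, h2, add_zero]
  smul_mem' := by
    intro c y hy x hx
    have h := hy x hx
    simp only [Pi.smul_apply, smul_eq_mul]
    calc ∑ i, x i * (c * y i) = c * ∑ i, x i * y i := by
          rw [Finset.mul_sum]; congr 1; ext i; ring
      _ = 0 := by rw [h, mul_zero]

/-- A coset coding scheme `CS` (a disjoint family of nonempty sets of codeword matrices)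
is universally `t`-error and `ρ`-erasure-correcting. -/
def UnivCorrecting (Fq : Type*) [Field Fq] {Fqm : Type*} [Field Fqm] [Algebra Fq Fqm]
    {α n ℓ : ℕ} (t ρ : ℕ)
    (CS : Matrix (Fin α) (Fin ℓ) Fqm → Set (Matrix (Fin α) (Fin n) Fqm)) : Prop :=
  ∀ N : ℕ, 1 ≤ N → ∀ A : Matrix (Fin N) (Fin n) Fq, n - ρ ≤ A.rank →
    ∃ D : Matrix (Fin α) (Fin N) Fqm → Matrix (Fin α) (Fin ℓ) Fqm,
      ∀ S X E, X ∈ CS S → rkMat Fq E ≤ t →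
        D (X * (A.map (algebraMap Fq Fqm))ᵀ + E) = S

/-- A coset coding scheme is universally secure under `μ` observations: for a uniform
message and codeword uniform on `CS S`, the distribution of `X Bᵀ` does not depend on `S`. -/
def UnivSecure (Fq : Type*) [Field Fq] {Fqm : Type*} [Field Fqm] [Algebra Fq Fqm]
    {α n ℓ : ℕ} (μ : ℕ)
    (CS : Matrix (Fin α) (Fin ℓ) Fqm → Set (Matrix (Fin α) (Fin n) Fqm)) : Prop :=
  ∀ (B : Matrix (Fin μ) (Fin n) Fq) (S₁ S₂ : Matrix (Fin α) (Fin ℓ) Fqm)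
    (W : Matrix (Fin α) (Fin μ) Fqm),
    ({X ∈ CS S₁ | X * (B.map (algebraMap Fq Fqm))ᵀ = W}).ncard * (CS S₂).ncard
      = ({X ∈ CS S₂ | X * (B.map (algebraMap Fq Fqm))ᵀ = W}).ncard * (CS S₁).ncard

/-- Preprocessing functions `EA i` (applied to the columns `C aᵢᵀ + eᵢ`) are
`t`-error-correcting with respect to the coset coding scheme `CS`. -/
def PreprocCorrecting (Fq : Type*) [Field Fq] {Fqm : Type*} [Field Fqm] [Algebra Fq Fqm]
    {α n ℓ d : ℕ} (t : ℕ) (A : Matrix (Fin d) (Fin n) Fq) {β : Fin d → ℕ}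
    (EA : ∀ i : Fin d, (Fin α → Fqm) → (Fin (β i) → Fqm))
    (CS : Matrix (Fin α) (Fin ℓ) Fqm → Set (Matrix (Fin α) (Fin n) Fqm)) : Prop :=
  ∃ D : (∀ i : Fin d, Fin (β i) → Fqm) → Matrix (Fin α) (Fin ℓ) Fqm,
    ∀ S C E, C ∈ CS S → rkMat Fq E ≤ t →
      D (fun i => EA i (fun r => (C * (A.map (algebraMap Fq Fqm))ᵀ) r i + E r i)) = S

/-- A matrix whose columns vanish outside a finite set `s` has rank at most `s.card`. -/
theorem rkMat_le_card_of_support {Fq Fqm : Type*} [Field Fq] [Field Fqm] [Algebra Fq Fqm]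
    {a N : ℕ} (E : Matrix (Fin a) (Fin N) Fqm) (s : Finset (Fin N))
    (h : ∀ j ∉ s, ∀ i, E i j = 0) : rkMat Fq E ≤ s.card := by
  classical
  have hspan : Submodule.span Fq (Set.range fun j : Fin N => fun i : Fin a => E i j) ≤
      Submodule.span Fq (s.image fun j => fun i : Fin a => E i j : Set (Fin a → Fqm)) := by
    rw [Submodule.span_le]
    rintro _ ⟨j, rfl⟩
    by_cases hj : j ∈ s
    · exact Submodule.subset_span (Finset.mem_coe.2 (Finset.mem_image_of_mem _ hj))
    · have hz : (fun i : Fin a => E i j) = 0 := funext (h j hj)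
      simp only [hz, SetLike.mem_coe, Submodule.zero_mem]
  have : Module.Finite Fq (Submodule.span Fq
      (s.image fun j => fun i : Fin a => E i j : Set (Fin a → Fqm))) :=
    FiniteDimensional.span_finset Fq _
  exact (Submodule.finrank_mono hspan).trans
    ((finrank_span_finset_le_card _).trans Finset.card_image_le)

/-- Two codewords with the same preprocessed symbols in the first `d - 2 * t` positions encode
the same message, if the preprocessing functions are `t`-error-correcting. -/
theorem PreprocCorrecting.message_eq {Fq Fqm : Type*} [Field Fq] [Field Fqm] [Algebra Fq Fqm]
    {α n ℓ d t : ℕ} {A : Matrix (Fin d) (Fin n) Fq} {β : Fin d → ℕ}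
    {EA : ∀ i : Fin d, (Fin α → Fqm) → (Fin (β i) → Fqm)}
    {CS : Matrix (Fin α) (Fin ℓ) Fqm → Set (Matrix (Fin α) (Fin n) Fqm)}
    (hEA : PreprocCorrecting Fq t A EA CS)
    {S T : Matrix (Fin α) (Fin ℓ) Fqm} {C C' : Matrix (Fin α) (Fin n) Fqm}
    (hC : C ∈ CS S) (hC' : C' ∈ CS T)
    (h : ∀ i : Fin d, (i : ℕ) < d - 2 * t →
      EA i (fun r => (C * (A.map (algebraMap Fq Fqm))ᵀ) r i) =
        EA i (fun r => (C' * (A.map (algebraMap Fq Fqm))ᵀ) r i)) : S = T := by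
  obtain ⟨D, hD⟩ := hEA
  set Y := C * (A.map (algebraMap Fq Fqm))ᵀ with hY
  set Y' := C' * (A.map (algebraMap Fq Fqm))ᵀ with hY'
  let E : Matrix (Fin α) (Fin d) Fqm := fun r i =>
    if d - 2 * t ≤ (i : ℕ) ∧ (i : ℕ) < d - t then Y' r i - Y r i else 0
  let E' : Matrix (Fin α) (Fin d) Fqm := fun r i =>
    if d - t ≤ (i : ℕ) then Y r i - Y' r i else 0
  have hE : rkMat Fq E ≤ t := by
    refine (rkMat_le_card_of_support E
      {i : Fin d | d - 2 * t ≤ (i : ℕ) ∧ (i : ℕ) < d - t} ?_).trans ?_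
    · intro j hj i
      exact if_neg (by simpa using hj)
    · rw [← Finset.card_map Fin.valEmbedding]
      refine (Finset.card_le_card (t := Finset.Ico (d - 2 * t) (d - t)) ?_).trans ?_
      · intro x hx
        obtain ⟨i, hi, rfl⟩ := Finset.mem_map.1 hx
        simpa using hi
      · rw [Nat.card_Ico]; omega
  have hE' : rkMat Fq E' ≤ t := by
    refine (rkMat_le_card_of_support E' {i : Fin d | d - t ≤ (i : ℕ)} ?_).trans ?_
    · intro j hj i
      exact if_neg (by simpa using hj)
    · rw [← Finset.card_map Fin.valEmbedding]
      refine (Finset.card_le_card (t := Finset.Ico (d - t) d) ?_).trans ?_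
      · intro x hx
        obtain ⟨i, hi, rfl⟩ := Finset.mem_map.1 hx
        simpa using hi
      · rw [Nat.card_Ico]; omega
  rw [← hD S C E hC hE, ← hD T C' E' hC' hE', ← hY, ← hY']
  congr 1
  funext i
  rcases lt_or_ge (i : ℕ) (d - 2 * t) with h₁ | h₁
  · have h₂ : ¬ d - t ≤ (i : ℕ) := by omega
    simpa only [E, E', h₂, not_le.2 h₁, false_and, if_false, add_zero] using h i h₁
  · rcases le_or_gt (d - t) (i : ℕ) with h₂ | h₂
    · simp only [E, E', h₂, not_lt.2 h₂, and_false, if_true, if_false, add_zero,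
        add_sub_cancel]
    · simp only [E, E', h₁, h₂, not_le.2 h₂, and_self, if_true, if_false, add_zero,
        add_sub_cancel]

/-- if the preprocessing functions `E_{A,1},…,E_{A,d}` are `t`-error-correcting,
then `E_{A,1},…,E_{A,d−2t}` are `0`-error-correcting (for the first `d − 2t` rows of `A`). -/
theorem stmt9 {Fq Fqm : Type*} [Field Fq] [Field Fqm] [Algebra Fq Fqm]
    [Fintype Fq] [Fintype Fqm]
    (q m α n ℓ d t : ℕ) (hq : IsPrimePow q)
    (hm : 0 < m) (hα : 0 < α) (hn : 0 < n) (hℓ : 0 < ℓ) (hd : 0 < d) (hdt : 2 * t ≤ d)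
    (hcq : Fintype.card Fq = q) (hcqm : Fintype.card Fqm = q ^ m)
    (CS : Matrix (Fin α) (Fin ℓ) Fqm → Set (Matrix (Fin α) (Fin n) Fqm))
    (hne : ∀ S, (CS S).Nonempty)
    (hdisj : ∀ S T, S ≠ T → Disjoint (CS S) (CS T))
    (A : Matrix (Fin d) (Fin n) Fq) (hA : A.rank = d)
    (β : Fin d → ℕ) (hβ : ∀ i, 1 ≤ β i)
    (EA : ∀ i : Fin d, (Fin α → Fqm) → (Fin (β i) → Fqm))
    (hEA : PreprocCorrecting Fq t A EA CS) :
    ∃ D : (∀ i : Fin (d - 2 * t), Fin (β (Fin.castLE (Nat.sub_le d (2 * t)) i)) → Fqm) →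
        Matrix (Fin α) (Fin ℓ) Fqm,
      ∀ S C, C ∈ CS S →
        D (fun i => EA (Fin.castLE (Nat.sub_le d (2 * t)) i)
            (fun r => (C * (A.map (algebraMap Fq Fqm))ᵀ) r
              (Fin.castLE (Nat.sub_le d (2 * t)) i))) = S := by
  let X := {p : Matrix (Fin α) (Fin ℓ) Fqm × Matrix (Fin α) (Fin n) Fqm // p.2 ∈ CS p.1}
  let f : X → ∀ i : Fin (d - 2 * t), Fin (β (Fin.castLE (Nat.sub_le d (2 * t)) i)) → Fqm :=
    fun p i => EA (Fin.castLE (Nat.sub_le d (2 * t)) i)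
      (fun r => (p.1.2 * (A.map (algebraMap Fq Fqm))ᵀ) r (Fin.castLE (Nat.sub_le d (2 * t)) i))
  have hf : Function.FactorsThrough (fun p : X => p.1.1) f := fun p p' hp =>
    hEA.message_eq p.2 p'.2 fun i hi => congrFun hp ⟨i, hi⟩
  exact ⟨Function.extend f (fun p => p.1.1) 0, fun S C hC =>
    hf.extend_apply 0 ⟨(S, C), hC⟩⟩
end

section
/- Let q be a prime power and m, n ≥ 1. Let C_2 ⊊ C_1 ⊆ F_{q^m}^n be F_{q^m}-linear codes with k_1 = dim(C_1), k_2 = dim(C_2), ℓ = k_1 − k_2, and let ρ_0 ≥ 1 satisfy ρ_0 < d_R(C_1, C_2). Let n − ρ_0 = d_h < d_{h−1} < … < d_1 ≤ n be integers and suppose there exist F_{q^m}-linear codes C_1 = C^{(h)} ⊊ C^{(h−1)} ⊊ … ⊊ C^{(1)} ⊆ F_{q^m}^n with d_R(C^{(j)}, C_2) ≥ n − d_j + 1 for j = 1,…,h. Set k^{(j)} = dim(C^{(j)}), α_j = k^{(j)} − k_2 and α = lcm(α_1,…,α_h). Then there exists a coset coding scheme (C_S) with message set F_{q^m}^{α×ℓ}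 and codeword set F_{q^m}^{α×n} such that: (1) for all integers t, ρ ≥ 0 with 2t + ρ < d_R(C_1, C_2), the scheme is universally t-error and ρ-erasure-correcting; (2) for every integer μ with 0 ≤ μ < d_R(C_2^⊥, (C^{(1)})^⊥), the scheme is universally secure under μ observations; (3) for every j ∈ {1,…,h} and every full-rank A ∈ F_q^{d_j×n} there exist preprocessing functions E_{A,i} : F_{q^m}^α → F_{q^m}^{ℓα/α_j} (i = 1,…,d_j) that are t-error-correcting with respect to the scheme for every integer t ≥ 0 with 2t + n − d_j < d_R(C^{(j)}, C_2); in particular their communication overhead is CO(A) = ℓ(d_j − k^{(j)} + k_2)/(k^{(j)} − k_2). -/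
open Matrix

/-- The `Fq`-rank of a vector drops by at most `ρ` when it is sent through an `Fq`-matrix whose
rank is at least `n - ρ`. -/
lemma rkVec_le_rkVec_mul_transpose_add {Fq Fqm : Type*} [Field Fq] [Field Fqm] [Algebra Fq Fqm]
    {n N ρ : ℕ} (A : Matrix (Fin N) (Fin n) Fq) (hA : n - ρ ≤ A.rank) (v : Fin n → Fqm) :
    rkVec Fq v ≤ rkVec Fq (fun k => ∑ i, v i * algebraMap Fq Fqm (A k i)) + ρ := by
  set φ : (Fin n → Fq) →ₗ[Fq] Fqm := Fintype.linearCombination Fq v with hφ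
  set R : Submodule Fq (Fin n → Fq) := Submodule.span Fq (Set.range A.row) with hR
  have hRrank : Module.finrank Fq R = A.rank := (A.rank_eq_finrank_span_row).symm
  have h1 : rkVec Fq v = Module.finrank Fq (LinearMap.range φ) := by
    rw [rkVec, hφ, Fintype.range_linearCombination]
  have h2 : rkVec Fq (fun k => ∑ i, v i * algebraMap Fq Fqm (A k i))
      = Module.finrank Fq (R.map φ) := by
    rw [rkVec, hR, Submodule.map_span, ← Set.range_comp]
    have : (fun k => ∑ i, v i * algebraMap Fq Fqm (A k i)) = φ ∘ A.row := by
      ext k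
      rw [hφ, Function.comp_apply, Fintype.linearCombination_apply]
      exact Finset.sum_congr rfl fun i _ => by rw [Algebra.smul_def, mul_comm]; rfl
    rw [this]
  have h3 := LinearMap.finrank_range_add_finrank_ker φ
  have h4 := LinearMap.finrank_range_add_finrank_ker (φ.domRestrict R)
  rw [LinearMap.range_domRestrict] at h4
  have h5 : Module.finrank Fq (LinearMap.ker (φ.domRestrict R))
      ≤ Module.finrank Fq (LinearMap.ker φ) := by
    rw [LinearMap.ker_domRestrict]
    rw [(Submodule.equivMapOfInjective R.subtype R.injective_subtype _).finrank_eq]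
    exact Submodule.finrank_mono (Submodule.map_comap_le _ _)
  rw [Module.finrank_fin_fun] at h3
  omega

lemma rkVec_row_le_rkMat {Fq Fqm : Type*} [Field Fq] [Field Fqm] [Algebra Fq Fqm]
    {a N : ℕ} (E : Matrix (Fin a) (Fin N) Fqm) (r : Fin a) :
    rkVec Fq (E r) ≤ rkMat Fq E := by
  have : Submodule.span Fq (Set.range (E r)) = (Submodule.span Fq
      (Set.range fun j : Fin N => fun i : Fin a => E i j)).map (LinearMap.proj r) := by
    rw [Submodule.map_span, ← Set.range_comp]
    rfl
  rw [rkVec, rkMat, this]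
  have := FiniteDimensional.span_of_finite Fq
    (Set.finite_range fun j : Fin N => fun i : Fin a => E i j)
  exact Submodule.finrank_map_le _ _

lemma rkVec_sub_le {Fq Fqm : Type*} [Field Fq] [Field Fqm] [Algebra Fq Fqm]
    {n : ℕ} (v w : Fin n → Fqm) : rkVec Fq (v - w) ≤ rkVec Fq v + rkVec Fq w := by
  have hv := FiniteDimensional.span_of_finite Fq (Set.finite_range v)
  have hw := FiniteDimensional.span_of_finite Fq (Set.finite_range w)
  refine (Submodule.finrank_mono ?_).trans (Submodule.finrank_add_le_finrank_add_finrank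
    (Submodule.span Fq (Set.range v)) (Submodule.span Fq (Set.range w)))
  rw [Submodule.span_le]
  rintro _ ⟨i, rfl⟩
  exact Submodule.sub_mem _ (Submodule.mem_sup_left (Submodule.subset_span ⟨i, rfl⟩))
    (Submodule.mem_sup_right (Submodule.subset_span ⟨i, rfl⟩))

/-- Two codewords that become indistinguishable after erasures and errors differ by an element
of the subcode. -/
lemma sub_mem_of_transmit_eq {Fq Fqm : Type*} [Field Fq] [Field Fqm] [Algebra Fq Fqm]
    {n N t ρ : ℕ} {C C2 : Submodule Fqm (Fin n → Fqm)}
    (hd : 2 * t + ρ < dRel Fq (C : Set (Fin n → Fqm)) (C2 : Set (Fin n → Fqm)))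
    (A : Matrix (Fin N) (Fin n) Fq) (hA : n - ρ ≤ A.rank)
    {x y : Fin n → Fqm} {e f : Fin N → Fqm} (he : rkVec Fq e ≤ t) (hf : rkVec Fq f ≤ t)
    (hxy : ∀ k, ∑ i, x i * algebraMap Fq Fqm (A k i) + e k
      = ∑ i, y i * algebraMap Fq Fqm (A k i) + f k)
    (hC : x - y ∈ C) : x - y ∈ C2 := by
  by_contra hC2
  have h1 : dRel Fq (C : Set (Fin n → Fqm)) (C2 : Set (Fin n → Fqm)) ≤ rkVec Fq (x - y) :=
    Nat.sInf_le ⟨x - y, hC, hC2, rfl⟩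
  have h2 := rkVec_le_rkVec_mul_transpose_add A hA (x - y)
  have h3 : (fun k => ∑ i, (x - y) i * algebraMap Fq Fqm (A k i)) = f - e := by
    ext k
    simp only [Pi.sub_apply, sub_mul, Finset.sum_sub_distrib]
    linear_combination hxy k
  rw [h3] at h2
  have h4 := rkVec_sub_le (Fq := Fq) f e
  omega

/-- Fewer observations than the relative dual distance cannot tell the code from the subcode. -/
lemma exists_mem_observe_eq {Fq Fqm : Type*} [Field Fq] [Field Fqm] [Algebra Fq Fqm]
    {n μ : ℕ} {C C2 : Submodule Fqm (Fin n → Fqm)}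
    (hμ : μ < dRel Fq (dualCode (C2 : Set (Fin n → Fqm)) : Set (Fin n → Fqm))
      (dualCode (C : Set (Fin n → Fqm)) : Set (Fin n → Fqm)))
    (B : Matrix (Fin μ) (Fin n) Fq) {x : Fin n → Fqm} (hx : x ∈ C) :
    ∃ c ∈ C2, (B.map (algebraMap Fq Fqm)).mulVec c = (B.map (algebraMap Fq Fqm)).mulVec x := by
  set B' := B.map (algebraMap Fq Fqm) with hB'
  by_contra hne
  have hx' : B'.mulVecLin x ∉ C2.map B'.mulVecLin := by
    rintro ⟨c, hc, h⟩
    exact hne ⟨c, hc, h⟩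
  obtain ⟨f, hf0, hf⟩ := Submodule.exists_dual_map_eq_bot_of_notMem hx' inferInstance
  set y : Fin μ → Fqm := fun k => f (Pi.single k 1) with hy
  have hfy : ∀ w, f w = y ⬝ᵥ w := by
    intro w
    rw [LinearMap.pi_apply_eq_sum_univ f w]
    simp only [dotProduct, hy, smul_eq_mul, mul_comm]
    refine Finset.sum_congr rfl fun k _ => ?_
    congr 2
    ext j
    simp [Pi.single_apply, eq_comm]
  have hdot : ∀ z, ∑ i, z i * (y ᵥ* B') i = f (B'.mulVecLin z) := by
    intro z
    rw [hfy, Matrix.mulVecLin_apply, Matrix.dotProduct_mulVec, dotProduct_comm]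
    rfl
  have h1 : dRel Fq (dualCode (C2 : Set (Fin n → Fqm)) : Set (Fin n → Fqm))
      (dualCode (C : Set (Fin n → Fqm)) : Set (Fin n → Fqm)) ≤ rkVec Fq (y ᵥ* B') := by
    refine Nat.sInf_le ⟨y ᵥ* B', ?_, ?_, rfl⟩
    · intro z hz
      rw [hdot]
      have : f (B'.mulVecLin z) ∈ (C2.map B'.mulVecLin).map f :=
        Submodule.mem_map_of_mem (Submodule.mem_map_of_mem hz)
      rwa [hf, Submodule.mem_bot] at this
    · intro h
      exact hf0 ((hdot x).symm.trans (h x hx))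
  have h2 : rkVec Fq (y ᵥ* B') ≤ μ := by
    have hfin := FiniteDimensional.span_of_finite Fq (Set.finite_range y)
    refine (Submodule.finrank_mono ?_).trans
      ((finrank_range_le_card (R := Fq) y).trans_eq (Fintype.card_fin μ))
    rw [Submodule.span_le]
    rintro _ ⟨i, rfl⟩
    rw [Matrix.vecMul, dotProduct, SetLike.mem_coe]
    refine Submodule.sum_mem _ fun k _ => ?_
    rw [hB', Matrix.map_apply, mul_comm, ← Algebra.smul_def]
    exact Submodule.smul_mem _ _ (Submodule.subset_span ⟨k, rfl⟩)
  omega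

/-- A linearly independent family adapted to a flag: its first `finrank (W j)` members lie in
`W j`. -/
lemma exists_linearIndependent_adapted {K V : Type*} [Field K] [AddCommGroup V] [Module K V]
    [FiniteDimensional K V] {h : ℕ} (W : Fin h → Submodule K V) (hW : Antitone W) (i₀ : Fin h)
    (k : ℕ) (hk : k ≤ Module.finrank K (W i₀)) :
    ∃ g : Fin k → V, LinearIndependent K g ∧
      ∀ j (c : Fin k), (c : ℕ) < Module.finrank K (W j) → g c ∈ W j := by
  induction k with
  | zero => exact ⟨Fin.elim0, linearIndependent_empty_type, fun _ c => c.elim0⟩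
  | succ k ih =>
    obtain ⟨g, hg, hgW⟩ := ih (by omega)
    obtain ⟨j, hj, hjmax⟩ := Finset.exists_max_image
      (Finset.univ.filter fun j => k < Module.finrank K (W j)) id ⟨i₀, by simp; omega⟩
    simp only [Finset.mem_filter, Finset.mem_univ, true_and, id] at hj hjmax
    obtain ⟨x, hxW, hx⟩ : ∃ x ∈ W j, x ∉ Submodule.span K (Set.range g) := by
      by_contra! hle
      have h1 := Submodule.finrank_mono (R := K) (s := W j) hle
      have h2 := finrank_range_le_card (R := K) g
      rw [Fintype.card_fin] at h2
      exact absurd (h1.trans h2) (by omega)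
    refine ⟨Fin.snoc g x, linearIndependent_finSnoc.2 ⟨hg, hx⟩, fun i c hc => ?_⟩
    induction c using Fin.lastCases with
    | last => simpa using hW (hjmax i (by simpa using hc)) hxW
    | cast c => simpa using hgW i c (by simpa using hc)

/-- The staircase arrangement: a linear array `M s` of symbols with rows `r` and columns `c`,
such that `s` can be recovered from the first `b j` rows by repeatedly reading off rows that are
supported on the first `a j` columns. -/
lemma exists_staircase {K V : Type*} [Field K] [AddCommGroup V] [Module K V]
    (a b : ℕ → ℕ) (ha : Antitone a) (hb : Monotone b) (hab : ∀ i, a (i + 1) * b (i + 1) = a i * b i)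
    (e : V ≃ₗ[K] (Fin (b 0) × Fin (a 0) → K)) (i : ℕ) :
    ∃ M : V →ₗ[K] ℕ → ℕ → K, ∀ j ≤ i, ∀ s,
      (∀ r < b j, (∀ c, a j ≤ c → c < a 0 → M s r c = 0) → ∀ c < a 0, M s r c = 0) → s = 0 := by
  induction i with
  | zero =>
    refine ⟨LinearMap.pi fun r => LinearMap.pi fun c =>
      if h : r < b 0 ∧ c < a 0 then LinearMap.proj (⟨r, h.1⟩, ⟨c, h.2⟩) ∘ₗ e.toLinearMap else 0,
      fun j hj s hs => ?_⟩
    obtain rfl : j = 0 := by omega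
    apply e.injective
    ext ⟨r, c⟩
    have := hs r r.2 (fun c h1 h2 => by omega) c c.2
    simpa using this
  | succ i ih =>
    obtain ⟨M, hM⟩ := ih
    have hai := ha (Nat.le_succ i)
    have ha0 := ha (Nat.zero_le i)
    have hbi := hb (Nat.le_succ i)
    simp only [Nat.succ_eq_add_one] at hai hbi
    have hcard : Fintype.card (Fin (b (i + 1) - b i) × Fin (a (i + 1)))
        = Fintype.card (Fin (b i) × Fin (a i - a (i + 1))) := by
      simp only [Fintype.card_prod, Fintype.card_fin]
      have := hab i
      zify [hai, hbi] at this ⊢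
      linear_combination this
    let φ := Fintype.equivOfCardEq hcard
    refine ⟨LinearMap.pi fun r => LinearMap.pi fun c =>
      if r < b i then LinearMap.proj c ∘ₗ LinearMap.proj r ∘ₗ M
      else if h : r - b i < b (i + 1) - b i ∧ c < a (i + 1) then
        LinearMap.proj (a (i + 1) + ((φ (⟨r - b i, h.1⟩, ⟨c, h.2⟩)).2 : ℕ)) ∘ₗ
          LinearMap.proj ((φ (⟨r - b i, h.1⟩, ⟨c, h.2⟩)).1 : ℕ) ∘ₗ M
      else 0, fun j hj s hs => ?_⟩
    rcases Nat.lt_or_ge i j with hij | hij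
    · obtain rfl : j = i + 1 := by omega
      have hzero : ∀ r < b i, ∀ c, a (i + 1) ≤ c → c < a i → M s r c = 0 := by
        intro r hr c hc hc'
        obtain ⟨⟨r', c'⟩, hrc⟩ := φ.surjective (⟨r, hr⟩, ⟨c - a (i + 1), by omega⟩)
        have h := hs (b i + r') (by omega) (fun c h1 h2 => by
          simp [show ¬ c < a (i + 1) by omega]) c' (by omega)
        simpa [hrc, Nat.add_sub_cancel' hc] using h
      refine hM i le_rfl s fun r hr hrow => ?_
      have h := hs r (by omega)
      simp only [LinearMap.pi_apply, hr, if_true, LinearMap.comp_apply, LinearMap.proj_apply] at h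
      refine h fun c h1 h2 => ?_
      rcases Nat.lt_or_ge c (a i) with h3 | h3
      · exact hzero r hr c h1 h3
      · exact hrow c h3 h2
    · refine hM j hij s fun r hr => ?_
      have h := hs r hr
      simpa only [LinearMap.pi_apply, hr.trans_le (hb hij), if_true, LinearMap.comp_apply,
        LinearMap.proj_apply] using h

lemma finrank_map_mkQ_of_le {K V : Type*} [Field K] [AddCommGroup V] [Module K V]
    [FiniteDimensional K V] {C2 C : Submodule K V} (h : C2 ≤ C) :
    Module.finrank K (C.map C2.mkQ) = Module.finrank K C - Module.finrank K C2 := by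
  have h4 := LinearMap.finrank_range_add_finrank_ker (C2.mkQ.domRestrict C)
  rw [LinearMap.range_domRestrict, LinearMap.ker_domRestrict, Submodule.ker_mkQ,
    (Submodule.comapSubtypeEquivOfLe h).finrank_eq] at h4
  omega

/-- Staircase encoder along a flag `Cc` of codes containing `C2`: a linear map producing rows of
`Cc i₀`, from whose first `b j` rows the message is recovered by reading off, modulo `C2`, rows
in `Cc j`. -/
lemma exists_staircase_encoder {K V U : Type*} [Field K] [AddCommGroup V] [Module K V]
    [FiniteDimensional K V] [AddCommGroup U] [Module K U] [FiniteDimensional K U]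
    {h : ℕ} (hh : 1 ≤ h) (Cc : Fin h → Submodule K V) (hCc : Antitone Cc)
    (C2 : Submodule K V) (hC2 : ∀ j, C2 < Cc j) (b : Fin h → ℕ)
    (hb : ∀ j, (Module.finrank K (Cc j) - Module.finrank K C2) * b j = Module.finrank K U) :
    ∃ P : U →ₗ[K] ℕ → V, (∀ s r, P s r ∈ Cc ⟨0, by omega⟩) ∧
      ∀ j s, (∀ r < b j, P s r ∈ Cc j → P s r ∈ C2) → s = 0 := by
  let ι : ℕ → Fin h := fun i => ⟨min i (h - 1), by omega⟩
  have hι : Monotone ι := fun i j hij => by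
    change min i (h - 1) ≤ min j (h - 1)
    omega
  have hιj : ∀ j : Fin h, ι j = j := fun j => Fin.ext (by simp only [ι]; omega)
  have hι0 : (⟨0, by omega⟩ : Fin h) = ι 0 := Fin.ext (by simp [ι])
  let W : Fin h → Submodule K (V ⧸ C2) := fun j => (Cc j).map C2.mkQ
  have hW : Antitone W := fun i j hij => Submodule.map_mono (hCc hij)
  let a : ℕ → ℕ := fun i => Module.finrank K (W (ι i))
  have ha : Antitone a := fun i j hij => Submodule.finrank_mono (hW (hι hij))
  have haW : ∀ i, a i = Module.finrank K (Cc (ι i)) - Module.finrank K C2 := fun i =>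
    finrank_map_mkQ_of_le (hC2 _).le
  have hapos : ∀ i, 0 < a i := fun i => by
    rw [haW]
    exact Nat.sub_pos_of_lt (Submodule.finrank_lt_finrank_of_lt (hC2 _))
  have hab : ∀ i, a i * b (ι i) = Module.finrank K U := fun i => by rw [haW, hb]
  have hbmono : Monotone fun i => b (ι i) := fun i j hij => by
    have h1 := (hab i).trans (hab j).symm
    have h2 := Nat.mul_le_mul_right (b (ι j)) (ha hij)
    exact Nat.le_of_mul_le_mul_left (h1.le.trans h2) (hapos i)
  have e : U ≃ₗ[K] (Fin (b (ι 0)) × Fin (a 0) → K) := LinearEquiv.ofFinrankEq _ _ (by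
    rw [← hab 0, Module.finrank_pi]
    simp [mul_comm])
  obtain ⟨M, hM⟩ := exists_staircase a (fun i => b (ι i)) ha hbmono
    (fun i => (hab (i + 1)).trans (hab i).symm) e (h - 1)
  obtain ⟨g, hg, hgW⟩ := exists_linearIndependent_adapted W hW (ι 0) (a 0) le_rfl
  choose g' hg' using fun c => C2.mkQ_surjective (g c)
  have hmem : ∀ j (c : Fin (a 0)), (c : ℕ) < a j → g' c ∈ Cc (ι j) := fun j c hc => by
    have h1 := hgW (ι j) c hc
    rw [← hg', ← Submodule.mem_comap, Submodule.comap_map_mkQ] at h1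
    simpa [(hC2 _).le] using h1
  refine ⟨LinearMap.pi fun r => ∑ c : Fin (a 0),
    (LinearMap.proj (c : ℕ) ∘ₗ LinearMap.proj r ∘ₗ M).smulRight (g' c), fun s r => ?_,
    fun j s hs => ?_⟩
  · rw [hι0, LinearMap.pi_apply, LinearMap.sum_apply]
    exact Submodule.sum_mem _ fun c _ => Submodule.smul_mem _ _ (hmem 0 c c.2)
  · simp only [LinearMap.pi_apply, LinearMap.sum_apply, LinearMap.smulRight_apply,
      LinearMap.comp_apply, LinearMap.proj_apply] at hs
    refine hM j (by omega) s fun r hr hrow c hc => ?_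
    simp only [hιj] at hr
    have h1 : ∑ c : Fin (a 0), M s r c • g' c ∈ C2 := by
      refine hs r hr (Submodule.sum_mem _ fun c _ => ?_)
      rcases Nat.lt_or_ge (c : ℕ) (a j) with hc | hc
      · simpa only [hιj] using Submodule.smul_mem _ _ (hmem j c hc)
      · rw [hrow c hc c.2, zero_smul]
        exact Submodule.zero_mem _
    rw [← Submodule.Quotient.mk_eq_zero, ← Submodule.mkQ_apply, map_sum] at h1
    simp only [map_smul, hg'] at h1
    exact Fintype.linearIndependent_iff.1 hg _ h1 ⟨c, hc⟩

/-- A decoder exists as soon as the message is determined by the output. -/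
lemma exists_decoder {Msg In Out : Type*} [Nonempty Msg] (P : Msg → In → Prop) (out : In → Out)
    (hP : ∀ s s' x x', P s x → P s' x' → out x = out x' → s = s') :
    ∃ D : Out → Msg, ∀ s x, P s x → D (out x) = s := by
  classical
  refine ⟨fun y => if hy : ∃ s x, P s x ∧ out x = y then hy.choose else Classical.arbitrary _,
    fun s x hx => ?_⟩
  have hy : ∃ s' x', P s' x' ∧ out x' = out x := ⟨s, x, hx, rfl⟩
  obtain ⟨x', hx', hxx'⟩ := hy.choose_spec
  simp only [dif_pos hy]
  exact hP _ _ _ _ hx' hx hxx'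

/-- the general construction (Theorem 3 of the paper). Given nested codes
`C2 ⊊ C1 = C^{(h)} ⊊ … ⊊ C^{(1)}` with `d_R(C^{(j)}, C2) ≥ n − d_j + 1` and
`α = lcm(α_1,…,α_h)` where `α_j = k^{(j)} − k_2`, there is a coset coding scheme on
`α × n` matrices with the stated correction, security and preprocessing properties.
Here `Cc j` is `C^{(j+1)}` and `d j` is `d_{j+1}` for `j : Fin h`. -/
theorem stmt10 {Fq Fqm : Type*} [Field Fq] [Field Fqm] [Algebra Fq Fqm]
    [Fintype Fq] [Fintype Fqm]
    (q m n ℓ k₁ k₂ ρ₀ h α : ℕ) (hq : IsPrimePow q)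
    (hm : 0 < m) (hn : 0 < n) (hh : 1 ≤ h)
    (hcq : Fintype.card Fq = q) (hcqm : Fintype.card Fqm = q ^ m)
    (C1 C2 : Submodule Fqm (Fin n → Fqm)) (hsub : C2 < C1)
    (hk₁ : k₁ = Module.finrank Fqm ↥C1) (hk₂ : k₂ = Module.finrank Fqm ↥C2)
    (hℓ : ℓ = k₁ - k₂)
    (hρ₀ : 1 ≤ ρ₀)
    (hρ₀d : ρ₀ < dRel Fq (C1 : Set (Fin n → Fqm)) (C2 : Set (Fin n → Fqm)))
    (d : Fin h → ℕ) (hd_anti : StrictAnti d) (hd_le : d ⟨0, by omega⟩ ≤ n)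
    (hd_last : d ⟨h - 1, by omega⟩ = n - ρ₀)
    (Cc : Fin h → Submodule Fqm (Fin n → Fqm)) (hCc_anti : StrictAnti Cc)
    (hCc_last : Cc ⟨h - 1, by omega⟩ = C1)
    (hCc_dR : ∀ j : Fin h,
      n - d j + 1 ≤ dRel Fq ((Cc j : Submodule Fqm (Fin n → Fqm)) : Set (Fin n → Fqm))
        (C2 : Set (Fin n → Fqm)))
    (hα : α = Finset.univ.lcm fun j : Fin h => Module.finrank Fqm ↥(Cc j) - k₂) :
    ∃ CS : Matrix (Fin α) (Fin ℓ) Fqm → Set (Matrix (Fin α) (Fin n) Fqm),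
      (∀ S, (CS S).Nonempty) ∧
      (∀ S T, S ≠ T → Disjoint (CS S) (CS T)) ∧
      (∀ t ρ : ℕ,
        2 * t + ρ < dRel Fq (C1 : Set (Fin n → Fqm)) (C2 : Set (Fin n → Fqm)) →
        UnivCorrecting Fq t ρ CS) ∧
      (∀ μ : ℕ,
        μ < dRel Fq (dualCode (C2 : Set (Fin n → Fqm)) : Set (Fin n → Fqm))
          (dualCode ((Cc ⟨0, by omega⟩ : Submodule Fqm (Fin n → Fqm)) : Set (Fin n → Fqm)) :
            Set (Fin n → Fqm)) →
        UnivSecure Fq μ CS) ∧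
      (∀ j : Fin h, ∀ A : Matrix (Fin (d j)) (Fin n) Fq, A.rank = d j →
        ∃ β : ℕ, β * (Module.finrank Fqm ↥(Cc j) - k₂) = ℓ * α ∧
          ∃ EA : Fin (d j) → (Fin α → Fqm) → (Fin β → Fqm),
            (∀ t : ℕ,
              2 * t + (n - d j) <
                dRel Fq ((Cc j : Submodule Fqm (Fin n → Fqm)) : Set (Fin n → Fqm))
                  (C2 : Set (Fin n → Fqm)) →
              PreprocCorrecting Fq t A (β := fun _ => β) EA CS) ∧
            ((d j : ℚ) * β / α - ℓ
              = (ℓ : ℚ) * ((d j : ℚ) - (Module.finrank Fqm ↥(Cc j) : ℚ) + (k₂ : ℚ))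
                / ((Module.finrank Fqm ↥(Cc j) : ℚ) - (k₂ : ℚ)))) := by
  subst hk₁ hk₂
  have hC2 : ∀ j, C2 < Cc j := fun j => hsub.trans_le (by
    rw [← hCc_last]
    exact hCc_anti.antitone (Fin.mk_le_mk.2 (by omega) : j ≤ ⟨h - 1, by omega⟩))
  set a : Fin h → ℕ := fun j => Module.finrank Fqm (Cc j) - Module.finrank Fqm C2 with ha
  have hapos : ∀ j, 0 < a j := fun j =>
    Nat.sub_pos_of_lt (Submodule.finrank_lt_finrank_of_lt (hC2 j))
  have hadvd : ∀ j, a j ∣ α := fun j => hα ▸ Finset.dvd_lcm (Finset.mem_univ j)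
  have hαpos : 0 < α := by
    rw [hα, Nat.pos_iff_ne_zero, Ne, Finset.lcm_eq_zero_iff]
    rintro ⟨j, -, hj⟩
    exact (hapos j).ne' hj
  have hlast : a ⟨h - 1, by omega⟩ = ℓ := by rw [hℓ, ← hCc_last]
  have hla : ∀ j, ℓ ≤ a j := fun j => by
    rw [← hlast]
    exact Nat.sub_le_sub_right (Submodule.finrank_mono (hCc_anti.antitone
      (Fin.mk_le_mk.2 (by omega) : j ≤ ⟨h - 1, by omega⟩))) _
  set b : Fin h → ℕ := fun j => ℓ * α / a j with hb
  have hba : ∀ j, b j * a j = ℓ * α := fun j =>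
    Nat.div_mul_cancel ((hadvd j).mul_left ℓ)
  have hbα : ∀ j, b j ≤ α := fun j =>
    Nat.div_le_of_le_mul (Nat.mul_le_mul_right α (hla j))
  obtain ⟨P, hP0, hP⟩ := exists_staircase_encoder (U := Matrix (Fin α) (Fin ℓ) Fqm) hh Cc
    hCc_anti.antitone C2 hC2 b (fun j => by
      rw [Module.finrank_matrix, Module.finrank_self, mul_one, Fintype.card_fin,
        Fintype.card_fin, mul_comm α, ← hba j, mul_comm])
  set CS : Matrix (Fin α) (Fin ℓ) Fqm → Set (Matrix (Fin α) (Fin n) Fqm) :=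
    fun S => {X | ∀ r : Fin α, X r - P S r ∈ C2} with hCS
  have hdecode : ∀ j S S' X X', X ∈ CS S → X' ∈ CS S' →
      (∀ r : Fin α, (r : ℕ) < b j → X r - X' r ∈ Cc j → X r - X' r ∈ C2) → S = S' := by
    intro j S S' X X' hX hX' hrow
    refine sub_eq_zero.1 (hP j (S - S') fun r hr hmem => ?_)
    have hrα : r < α := hr.trans_le (hbα j)
    have h1 : (X ⟨r, hrα⟩ - X' ⟨r, hrα⟩) - P (S - S') r ∈ C2 := by
      convert Submodule.sub_mem _ (hX ⟨r, hrα⟩) (hX' ⟨r, hrα⟩) using 1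
      simp only [map_sub, Pi.sub_apply]
      abel
    have h2 := hrow ⟨r, hrα⟩ hr (by
      simpa using Submodule.add_mem _ ((hC2 j).le h1) hmem)
    simpa using Submodule.sub_mem _ h2 h1
  refine ⟨CS, fun S => ⟨fun r => P S r, fun r => ?_⟩, fun S T hST => ?_, ?_, ?_, ?_⟩
  · simp
  · rw [Set.disjoint_left]
    intro X hX hX'
    exact hST (hdecode ⟨0, by omega⟩ S T X X hX hX' fun r _ _ => by simp)
  · intro t ρ hd N _ A hA
    obtain ⟨D, hD⟩ := exists_decoder
      (P := fun S (XE : Matrix (Fin α) (Fin n) Fqm × Matrix (Fin α) (Fin N) Fqm) =>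
        XE.1 ∈ CS S ∧ rkMat Fq XE.2 ≤ t)
      (out := fun XE => XE.1 * (A.map (algebraMap Fq Fqm))ᵀ + XE.2) (by
        rintro S S' ⟨X, E⟩ ⟨X', E'⟩ ⟨hX, hE⟩ ⟨hX', hE'⟩ hout
        refine hdecode ⟨h - 1, by omega⟩ S S' X X' hX hX' fun r _ hmem => ?_
        rw [hCc_last] at hmem
        exact sub_mem_of_transmit_eq hd A hA ((rkVec_row_le_rkMat E r).trans hE)
          ((rkVec_row_le_rkMat E' r).trans hE') (fun k => congrFun (congrFun hout r) k) hmem)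
    exact ⟨D, fun S X E hX hE => hD S (X, E) ⟨hX, hE⟩⟩
  · intro μ hμ B S₁ S₂ W
    choose c hc hcB using fun r : Fin α => exists_mem_observe_eq hμ B (hP0 (S₂ - S₁) r)
    let Z : Matrix (Fin α) (Fin n) Fqm := Matrix.of fun r => P (S₂ - S₁) r - c r
    have hZB : Z * (B.map (algebraMap Fq Fqm))ᵀ = 0 := by
      ext r k
      have := congrFun (hcB r) k
      simp only [Matrix.mulVec, dotProduct] at this
      simp only [Matrix.mul_apply, Z, Matrix.of_apply, Pi.sub_apply, sub_mul,
        Finset.sum_sub_distrib, Matrix.transpose_apply, Matrix.zero_apply]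
      simp only [mul_comm] at this ⊢
      rw [this, sub_self]
    have hmem : ∀ X, X + Z ∈ CS S₂ ↔ X ∈ CS S₁ := fun X => forall_congr' fun r => by
      have : (X + Z) r - P S₂ r = (X r - P S₁ r) - c r := by
        change X r + (P (S₂ - S₁) r - c r) - P S₂ r = _
        simp only [map_sub, Pi.sub_apply]
        abel
      rw [this, Submodule.sub_mem_iff_left _ (hc r)]
    have h1 : (CS S₁).ncard = (CS S₂).ncard :=
      Set.ncard_congr (fun X _ => X + Z) (fun X hX => (hmem X).2 hX)
        (fun X Y _ _ hXY => add_right_cancel hXY)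
        (fun Y hY => ⟨Y - Z, (hmem _).1 (by simpa using hY), by simp⟩)
    have h2 : ({X ∈ CS S₁ | X * (B.map (algebraMap Fq Fqm))ᵀ = W}).ncard
        = ({X ∈ CS S₂ | X * (B.map (algebraMap Fq Fqm))ᵀ = W}).ncard :=
      Set.ncard_congr (fun X _ => X + Z)
        (fun X hX => ⟨(hmem X).2 hX.1, by rw [Matrix.add_mul, hZB, add_zero, hX.2]⟩)
        (fun X Y _ _ hXY => add_right_cancel hXY)
        (fun Y hY => ⟨Y - Z, ⟨(hmem _).1 (by simpa using hY.1), by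
          rw [Matrix.sub_mul, hZB, sub_zero, hY.2]⟩, by simp⟩)
    rw [h1, h2]
  · intro j A hA
    refine ⟨b j, hba j, fun _ x r => x (Fin.castLE (hbα j) r), fun t hd => ?_, ?_⟩
    · obtain ⟨D, hD⟩ := exists_decoder
        (P := fun S (XE : Matrix (Fin α) (Fin n) Fqm × Matrix (Fin α) (Fin (d j)) Fqm) =>
          XE.1 ∈ CS S ∧ rkMat Fq XE.2 ≤ t)
        (out := fun XE (i : Fin (d j)) (r : Fin (b j)) =>
          (XE.1 * (A.map (algebraMap Fq Fqm))ᵀ) (Fin.castLE (hbα j) r) i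
            + XE.2 (Fin.castLE (hbα j) r) i) (by
          rintro S S' ⟨X, E⟩ ⟨X', E'⟩ ⟨hX, hE⟩ ⟨hX', hE'⟩ hout
          refine hdecode j S S' X X' hX hX' fun r hr hmem => ?_
          exact sub_mem_of_transmit_eq hd A (by omega) ((rkVec_row_le_rkMat E r).trans hE)
            ((rkVec_row_le_rkMat E' r).trans hE')
            (fun k => congrFun (congrFun hout k) ⟨r, hr⟩) hmem)
      exact ⟨D, fun S X E hX hE => hD S (X, E) ⟨hX, hE⟩⟩
    · have h1 : (a j : ℚ) = (Module.finrank Fqm (Cc j) : ℚ) - (Module.finrank Fqm C2 : ℚ) :=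
        Nat.cast_sub (Submodule.finrank_mono (hC2 j).le)
      have h2 : (b j : ℚ) * a j = ℓ * α := by exact_mod_cast hba j
      have h3 : (a j : ℚ) ≠ 0 := by exact_mod_cast (hapos j).ne'
      have h4 : (α : ℚ) ≠ 0 := by exact_mod_cast hαpos.ne'
      rw [← h1, show (d j : ℚ) - (Module.finrank Fqm (Cc j) : ℚ) + (Module.finrank Fqm C2 : ℚ)
        = d j - a j by rw [h1]; ring]
      field_simp
      linear_combination (d j : ℚ) * h2
end
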